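/- Let q ≥ 2 be a natural number, let a < b be real numbers, and let f : [a,b] → ℝ be continuously differentiable. Then there exists a unique real polynomial p of degree at most q such that p(a) = f(a), p(b) = f(b), p'(b) = f'(b), and ∫_a^b (p'(t) − f'(t)) χ(t) dt = 0 for every real polynomial χ of degree at most q − 2. -/

import Mathlib

open Set

open Polynomial in
theorem Polynomial.eq_zero_of_eval_right_eq_zero_of_integral_mul_eq_zero
    {a b : ℝ} (hab : a < b) {n : ℕ} {g : ℝ[X]} (hg : g.natDegree ≤ n + 1)
    (hb : g.eval b = 0)
    (horth : ∀ χ : ℝ[X], χ.natDegree ≤ n → (∫ t in a..b, g.eval t * χ.eval t) = 0) :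
    g = 0 := by
  obtain ⟨h, rfl⟩ := dvd_iff_isRoot.mpr hb
  by_contra hne
  have hh : h ≠ 0 := right_ne_zero_of_mul hne
  have hdeg : h.natDegree ≤ n := by
    rw [natDegree_mul (X_sub_C_ne_zero b) hh, natDegree_X_sub_C] at hg
    omega
  obtain ⟨c, hc, hc0⟩ : ∃ c ∈ Ioo a b, h.eval c ≠ 0 := by
    by_contra! hroot
    exact hh (h.eq_zero_of_infinite_isRoot ((Ioo_infinite hab).mono hroot))
  have hpos : 0 < ∫ t in a..b, (b - t) * h.eval t ^ 2 := by
    refine intervalIntegral.integral_pos hab (by fun_prop) (fun t ht => ?_)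
      ⟨c, Ioo_subset_Icc_self hc, ?_⟩
    · exact mul_nonneg (sub_nonneg.mpr ht.2) (sq_nonneg _)
    · exact mul_pos (sub_pos.mpr hc.2) (by positivity)
  have hneg : (∫ t in a..b, (b - t) * h.eval t ^ 2) =
      -∫ t in a..b, ((X - C b) * h).eval t * h.eval t := by
    rw [← intervalIntegral.integral_neg]
    congr 1
    ext t
    simp only [eval_mul, eval_sub, eval_X, eval_C]
    ring
  rw [hneg, horth h hdeg] at hpos
  simp at hpos

open Polynomial in
theorem Polynomial.eq_zero_of_derivative_integral_mul_eq_zero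
    {a b : ℝ} (hab : a < b) {n : ℕ} {p : ℝ[X]} (hp : p.natDegree ≤ n + 2)
    (ha : p.eval a = 0) (hb : p.derivative.eval b = 0)
    (horth : ∀ χ : ℝ[X], χ.natDegree ≤ n →
      (∫ t in a..b, p.derivative.eval t * χ.eval t) = 0) :
    p = 0 := by
  have hd : p.derivative = 0 :=
    eq_zero_of_eval_right_eq_zero_of_integral_mul_eq_zero hab
      ((natDegree_derivative_le p).trans (by omega)) hb horth
  rw [eq_C_of_derivative_eq_zero hd] at ha ⊢
  simpa using ha

open Polynomial in
theorem Polynomial.intervalIntegrable_mul_eval {a b : ℝ} {g : ℝ → ℝ}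
    (hg : IntervalIntegrable g MeasureTheory.volume a b) (χ : ℝ[X]) :
    IntervalIntegrable (fun t => g t * χ.eval t) MeasureTheory.volume a b :=
  hg.mul_continuousOn χ.continuous.continuousOn

open Polynomial in
/-- The functional `χ ↦ ∫ t in a..b, g t * χ t` on polynomials of degree less than `m`. -/
noncomputable def integralMulFunctional {a b : ℝ} {g : ℝ → ℝ}
    (hg : IntervalIntegrable g MeasureTheory.volume a b) (m : ℕ) :
    degreeLT ℝ m →ₗ[ℝ] ℝ where
  toFun χ := ∫ t in a..b, g t * (χ : ℝ[X]).eval t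
  map_add' χ ψ := by
    rw [← intervalIntegral.integral_add (intervalIntegrable_mul_eval hg _)
      (intervalIntegrable_mul_eval hg _)]
    simp [mul_add]
  map_smul' c χ := by
    rw [RingHom.id_apply, smul_eq_mul, ← intervalIntegral.integral_const_mul]
    congr 1
    ext t
    simp only [SetLike.val_smul, eval_smul, smul_eq_mul]
    ring

open Polynomial in
/-- The data `(p(a), p'(b), χ ↦ ∫ t in a..b, p' t * χ t)` determining a polynomial of degree
less than `n + 3`, where `χ` ranges over polynomials of degree less than `n + 1`. -/
noncomputable def projectionData (a b : ℝ) (n : ℕ) :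
    degreeLT ℝ (n + 3) →ₗ[ℝ] ℝ × ℝ × Module.Dual ℝ (degreeLT ℝ (n + 1)) where
  toFun p := ((p : ℝ[X]).eval a, (derivative (p : ℝ[X])).eval b,
    integralMulFunctional ((derivative (p : ℝ[X])).continuous.intervalIntegrable a b) (n + 1))
  map_add' p r := by
    refine Prod.ext (by simp) (Prod.ext (by simp) (LinearMap.ext fun χ => ?_))
    simp only [Prod.snd_add, LinearMap.add_apply, integralMulFunctional, LinearMap.coe_mk,
      AddHom.coe_mk]
    rw [← intervalIntegral.integral_add
      (intervalIntegrable_mul_eval ((derivative (p : ℝ[X])).continuous.intervalIntegrable a b) _)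
      (intervalIntegrable_mul_eval ((derivative (r : ℝ[X])).continuous.intervalIntegrable a b) _)]
    simp [add_mul]
  map_smul' c p := by
    refine Prod.ext (by simp) (Prod.ext (by simp) (LinearMap.ext fun χ => ?_))
    simp only [Prod.smul_snd, LinearMap.smul_apply, integralMulFunctional, LinearMap.coe_mk,
      AddHom.coe_mk, RingHom.id_apply, smul_eq_mul]
    rw [← intervalIntegral.integral_const_mul]
    simp [mul_assoc]

open Polynomial in
theorem Polynomial.mem_degreeLT_succ_iff_natDegree_le {n : ℕ} {p : ℝ[X]} :
    p ∈ degreeLT ℝ (n + 1) ↔ p.natDegree ≤ n := by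
  rw [degreeLT_succ_eq_degreeLE, mem_degreeLE, natDegree_le_iff_degree_le]

open Polynomial in
theorem projectionData_injective {a b : ℝ} (hab : a < b) (n : ℕ) :
    Function.Injective (projectionData a b n) := by
  rw [injective_iff_map_eq_zero]
  intro p hp
  obtain ⟨ha, hb, hχ⟩ : (p : ℝ[X]).eval a = 0 ∧ (derivative (p : ℝ[X])).eval b = 0 ∧ _ = _ :=
    ⟨congrArg Prod.fst hp, congrArg (fun x => x.2.1) hp, congrArg (fun x => x.2.2) hp⟩
  refine Subtype.ext (eq_zero_of_derivative_integral_mul_eq_zero hab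
    (mem_degreeLT_succ_iff_natDegree_le.mp p.2) ha hb fun χ hdeg => ?_)
  exact LinearMap.congr_fun hχ ⟨χ, mem_degreeLT_succ_iff_natDegree_le.mpr hdeg⟩

open Polynomial in
theorem projectionData_surjective {a b : ℝ} (hab : a < b) (n : ℕ) :
    Function.Surjective (projectionData a b n) := by
  have hfin (m : ℕ) : Module.Finite ℝ (degreeLT ℝ m) :=
    Module.Finite.equiv (degreeLTEquiv ℝ m).symm
  have hrank (m : ℕ) : Module.finrank ℝ (degreeLT ℝ m) = m := by
    rw [(degreeLTEquiv ℝ m).finrank_eq, Module.finrank_fin_fun]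
  have := hfin (n + 1)
  have := hfin (n + 3)
  refine (LinearMap.injective_iff_surjective_of_finrank_eq_finrank ?_).mp
    (projectionData_injective hab n)
  rw [Module.finrank_prod, Module.finrank_prod, Subspace.dual_finrank_eq, hrank, hrank,
    Module.finrank_self]
  omega

/-- Existence and uniqueness of the modified `L²`-projection in time on a single
interval: for `q ≥ 2` and a `C¹` function `f` on `[a,b]` there is a unique polynomial
`p` of degree at most `q` with `p(a) = f(a)`, `p(b) = f(b)`, `p'(b) = f'(b)` and
`∫_a^b (p'(t) − f'(t)) χ(t) dt = 0` for every polynomial `χ` of degree at most `q − 2`. -/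
theorem modified_L2_projection_exists_unique
    (q : ℕ) (hq : 2 ≤ q) (a b : ℝ) (hab : a < b)
    (f f' : ℝ → ℝ)
    (hf : ∀ t ∈ Icc a b, HasDerivWithinAt f (f' t) (Icc a b) t)
    (hf' : ContinuousOn f' (Icc a b)) :
    ∃! p : Polynomial ℝ,
      p.natDegree ≤ q ∧
      p.eval a = f a ∧
      p.eval b = f b ∧
      (Polynomial.derivative p).eval b = f' b ∧
      ∀ χ : Polynomial ℝ, χ.natDegree ≤ q - 2 →
        (∫ t in a..b, ((Polynomial.derivative p).eval t - f' t) * χ.eval t) = 0 := by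
  obtain ⟨n, rfl⟩ := Nat.exists_eq_add_of_le' hq
  simp only [Nat.add_sub_cancel]
  have hint : IntervalIntegrable f' MeasureTheory.volume a b :=
    (uIcc_of_le hab.le ▸ hf').intervalIntegrable
  have hint' (p : Polynomial ℝ) :
      IntervalIntegrable (fun t => (Polynomial.derivative p).eval t) MeasureTheory.volume a b :=
    (Polynomial.derivative p).continuous.intervalIntegrable a b
  have hsplit (p χ : Polynomial ℝ) :
      (∫ t in a..b, ((Polynomial.derivative p).eval t - f' t) * χ.eval t) =
        (∫ t in a..b, (Polynomial.derivative p).eval t * χ.eval t) -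
          ∫ t in a..b, f' t * χ.eval t := by
    simp only [sub_mul]
    exact intervalIntegral.integral_sub (Polynomial.intervalIntegrable_mul_eval (hint' p) χ)
      (Polynomial.intervalIntegrable_mul_eval hint χ)
  obtain ⟨p, hp⟩ := projectionData_surjective hab n
    (f a, f' b, integralMulFunctional hint (n + 1))
  have ha : (p : Polynomial ℝ).eval a = f a := congrArg Prod.fst hp
  have hb : (Polynomial.derivative (p : Polynomial ℝ)).eval b = f' b :=
    congrArg (fun x => x.2.1) hp
  have horth (χ : Polynomial ℝ) (hχ : χ.natDegree ≤ n) :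
      (∫ t in a..b, (Polynomial.derivative (p : Polynomial ℝ)).eval t * χ.eval t) =
        ∫ t in a..b, f' t * χ.eval t :=
    LinearMap.congr_fun (congrArg (fun x => x.2.2) hp)
      ⟨χ, Polynomial.mem_degreeLT_succ_iff_natDegree_le.mpr hχ⟩
  refine ⟨p, ⟨Polynomial.mem_degreeLT_succ_iff_natDegree_le.mp p.2, ha, ?_, hb,
    fun χ hχ => by rw [hsplit, horth χ hχ, sub_self]⟩, ?_⟩
  · have hFTC : (∫ t in a..b, f' t) = f b - f a :=
      intervalIntegral.integral_eq_sub_of_hasDerivAt_of_le hab.le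
        (fun t ht => (hf t ht).continuousWithinAt)
        (fun t ht => (hf t (Ioo_subset_Icc_self ht)).hasDerivAt (Icc_mem_nhds ht.1 ht.2)) hint
    have hFTCp := intervalIntegral.integral_eq_sub_of_hasDerivAt
      (fun t _ => (p : Polynomial ℝ).hasDerivAt t) (hint' p)
    have hone := horth 1 (by simp)
    simp only [Polynomial.eval_one, mul_one] at hone
    linarith
  · rintro r ⟨hdeg, hra, -, hrb, hr⟩
    have hmem := Polynomial.mem_degreeLT_succ_iff_natDegree_le.mpr hdeg
    refine congrArg Subtype.val (projectionData_injective hab n (a₁ := ⟨r, hmem⟩) (a₂ := p) ?_)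
    rw [hp]
    refine Prod.ext hra (Prod.ext hrb (LinearMap.ext fun χ => ?_))
    have := hr χ (Polynomial.mem_degreeLT_succ_iff_natDegree_le.mp χ.2)
    rw [hsplit, sub_eq_zero] at this
    exact this
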